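/- arXiv:1507.01496 — 2 statements merged into one kernel-verified Lean document; each statement's English description precedes it below -/
import Mathlib

section
/- Let $n \ge 1$, let $U, V \in \mathbb{C}^{n\times n}$, and let $p, \tilde p, q, \tilde q \in \mathbb{C}[X]$. Set $A = p(U)\,\tilde p(V)$ and $B = q(U)\,\tilde q(V)$. Suppose $x_{ik} \in \mathbb{C}$ (for $0 \le i,k \le n-1$) and $y_{jl} \in \mathbb{C}$ (for $0 \le j,l \le n-1$) are ANY solutions of the linear systems $\sum_{i,k} x_{ik}\, U^i V^k = A$ and $\sum_{j,l} y_{jl}\, U^j V^l = B$. Then $\sum_{i=0}^{n-1}\sum_{j=0}^{n-1}\sum_{k=0}^{n-1}\sum_{l=0}^{n-1} x_{ik}\, y_{jl}\, U^{i+j} V^{k+l} = p(U)\, B\, \tilde p(V)$, i.e., the quadruple sum computed from any solutions of the public linear systems equals the shared secret key $K$. -/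
open Polynomial

theorem pow_mul_aeval_comm {R S : Type*} [CommSemiring R] [Semiring S] [Algebra R S]
    (a : S) (f : Polynomial R) (i : ℕ) : a ^ i * aeval a f = aeval a f * a ^ i := by
  rw [← aeval_X_pow (R := R) a, ← map_mul, mul_comm, map_mul]

theorem attack_one_correct (n : ℕ) (hn : 1 ≤ n)
    (U V : Matrix (Fin n) (Fin n) ℂ)
    (p p' q q' : Polynomial ℂ)
    (A B : Matrix (Fin n) (Fin n) ℂ)
    (hA : A = aeval U p * aeval V p')
    (hB : B = aeval U q * aeval V q')
    (x y : Fin n → Fin n → ℂ)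
    (hx : ∑ i : Fin n, ∑ k : Fin n, x i k • (U ^ (i : ℕ) * V ^ (k : ℕ)) = A)
    (hy : ∑ j : Fin n, ∑ l : Fin n, y j l • (U ^ (j : ℕ) * V ^ (l : ℕ)) = B) :
    ∑ i : Fin n, ∑ j : Fin n, ∑ k : Fin n, ∑ l : Fin n,
        (x i k * y j l) • (U ^ ((i : ℕ) + (j : ℕ)) * V ^ ((k : ℕ) + (l : ℕ))) =
      aeval U p * B * aeval V p' := by
  have hU (i : ℕ) : U ^ i * aeval U q = aeval U q * U ^ i := pow_mul_aeval_comm U q i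
  have hV (k : ℕ) : V ^ k * aeval V q' = aeval V q' * V ^ k := pow_mul_aeval_comm V q' k
  have hUpq : aeval U p * aeval U q = aeval U q * aeval U p := by
    rw [← map_mul, mul_comm, map_mul]
  have hVpq : aeval V p' * aeval V q' = aeval V q' * aeval V p' := by
    rw [← map_mul, mul_comm, map_mul]
  calc
    _ = ∑ i : Fin n, ∑ k : Fin n, x i k • (U ^ (i : ℕ) * B * V ^ (k : ℕ)) := by
      refine Finset.sum_congr rfl fun i _ => ?_
      rw [Finset.sum_comm]
      refine Finset.sum_congr rfl fun k _ => ?_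
      simp only [← hy, Finset.mul_sum, Finset.sum_mul, Finset.smul_sum, mul_smul_comm,
        smul_mul_assoc, smul_smul]
      refine Finset.sum_congr rfl fun j _ => Finset.sum_congr rfl fun l _ => ?_
      rw [pow_add, add_comm (k : ℕ), pow_add]
      simp only [mul_assoc]
    _ = aeval U q * A * aeval V q' := by
      simp only [← hx, Finset.mul_sum, Finset.sum_mul, mul_smul_comm, smul_mul_assoc]
      refine Finset.sum_congr rfl fun i _ => Finset.sum_congr rfl fun k _ => ?_
      rw [hB, ← mul_assoc, hU, mul_assoc _ (aeval V q'), ← hV]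
      simp only [mul_assoc]
    _ = aeval U p * B * aeval V p' := by
      rw [hA, hB, ← mul_assoc, ← hUpq, mul_assoc _ (aeval V p'), hVpq]
      simp only [mul_assoc]
end

section
/- Let $n \ge 1$, let $U, V \in \mathbb{C}^{n\times n}$, let $p, \tilde p, q, \tilde q \in \mathbb{C}[X]$, and set $A = p(U)\,\tilde p(V)$ and $B = q(U)\,\tilde q(V)$. Suppose $B = \sum_{i=0}^{r} \alpha_i\, U^{k_i} V^{l_i}$ for some scalars $\alpha_i \in \mathbb{C}$ and exponents $k_i, l_i \in \mathbb{N}$. Then $\sum_{i=0}^{r} \alpha_i\, U^{k_i}\, A\, V^{l_i} = q(U)\, A\, \tilde q(V)$, i.e., the matrix computed by the linear decomposition attack from public data equals Bob's computed shared key $K_B$. -/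
open Polynomial

theorem aeval_mul_mul_aeval_comm {R S : Type*} [CommSemiring R] [Semiring S] [Algebra R S]
    (u v : S) (f f' g g' : R[X]) :
    aeval u f * (aeval u g * aeval v g') * aeval v f' =
      aeval u g * (aeval u f * aeval v f') * aeval v g' := by
  simp only [← mul_assoc, ← map_mul, mul_comm f g]
  simp only [mul_assoc, ← map_mul, mul_comm f' g']

theorem attack_recovers_shared_key (n : ℕ) (hn : 1 ≤ n)
    (U V : Matrix (Fin n) (Fin n) ℂ)
    (p p' q q' : Polynomial ℂ)
    (A B : Matrix (Fin n) (Fin n) ℂ)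
    (hA : A = aeval U p * aeval V p')
    (hB : B = aeval U q * aeval V q')
    (r : ℕ) (α : Fin (r + 1) → ℂ) (k l : Fin (r + 1) → ℕ)
    (hBdec : B = ∑ i : Fin (r + 1), α i • (U ^ k i * V ^ l i)) :
    ∑ i : Fin (r + 1), α i • (U ^ k i * A * V ^ l i) = aeval U q * A * aeval V q' := by
  calc ∑ i, α i • (U ^ k i * A * V ^ l i)
      = aeval U p * B * aeval V p' := by
        rw [hBdec, Finset.mul_sum, Finset.sum_mul]
        refine Finset.sum_congr rfl fun i _ => ?_
        rw [mul_smul_comm, smul_mul_assoc, hA]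
        have h := aeval_mul_mul_aeval_comm U V p p' (X ^ k i) (X ^ l i)
        simp only [aeval_X_pow] at h
        rw [h]
    _ = aeval U q * A * aeval V q' := by
        rw [hA, hB, aeval_mul_mul_aeval_comm]
end
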